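/- Gold's class, consisting of ℕ together with all initial segments {0,1,...,m} for m ∈ ℕ, is not weakly approximately (WeakApprox) learnable: no learner WeakApprox-learns this class. -/

import Mathlib

open Filter

/-- The `e`-th partial recursive function in a fixed acceptable numbering. -/
def phi (e : ℕ) : ℕ →. ℕ := Nat.Partrec.Code.eval (Denumerable.ofNat Nat.Partrec.Code e)

/-- The `e`-th recursively enumerable set, `W_e = dom(φ_e)`. -/
def Wset (e : ℕ) : Set ℕ := (phi e).Dom

/-- `T` is a text for `L`: the natural numbers occurring in `T` are exactly
the members of `L` (`none` plays the role of the pause symbol `#`). -/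
def IsText (T : ℕ → Option ℕ) (L : Set ℕ) : Prop :=
  {x : ℕ | ∃ n, T n = some x} = L

/-- The finite sequence `T[n] = T(0), ..., T(n-1)`. -/
def pref (T : ℕ → Option ℕ) (n : ℕ) : List (Option ℕ) :=
  (List.range n).map T

/-- `M` partially (Part) learns `C`: on every text for every `L ∈ C` there is
exactly one index output infinitely often, and that index is an index of `L`. -/
def PartLearns (M : List (Option ℕ) → ℕ) (C : Set (Set ℕ)) : Prop :=
  ∀ L ∈ C, ∀ T : ℕ → Option ℕ, IsText T L →
    ∃ e, {n | M (pref T n) = e}.Infinite ∧ Wset e = L ∧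
      ∀ d, {n | M (pref T n) = d}.Infinite → d = e

/-- `M` is consistent (Cons): every number occurring in `σ` belongs to `W_{M(σ)}`. -/
def ConsLearner (M : List (Option ℕ) → ℕ) : Prop :=
  ∀ σ : List (Option ℕ), ∀ x : ℕ, some x ∈ σ → x ∈ Wset (M σ)

/-- `M` finitely approximately (FinApprox) learns `C`. -/
def FinApproxLearns (M : List (Option ℕ) → ℕ) (C : Set (Set ℕ)) : Prop :=
  ∀ L ∈ C, ∀ T : ℕ → Option ℕ, IsText T L → ∀ D : Finset ℕ,
    ∀ᶠ n in atTop, Wset (M (pref T n)) ∩ ↑D = L ∩ ↑D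

/-- `M` BC*-learns `C`: almost all hypotheses are finite variants of the target. -/
def BCstarLearns (M : List (Option ℕ) → ℕ) (C : Set (Set ℕ)) : Prop :=
  ∀ L ∈ C, ∀ T : ℕ → Option ℕ, IsText T L →
    ∀ᶠ n in atTop, (symmDiff (Wset (M (pref T n))) L).Finite

/-- `M` BC^k-learns `C`: almost all hypotheses differ from the target in at
most `k` elements. -/
def BCnLearns (k : ℕ) (M : List (Option ℕ) → ℕ) (C : Set (Set ℕ)) : Prop :=
  ∀ L ∈ C, ∀ T : ℕ → Option ℕ, IsText T L →
    ∀ᶠ m in atTop, (symmDiff (Wset (M (pref T m))) L).Finite ∧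
      (symmDiff (Wset (M (pref T m))) L).ncard ≤ k

/-- `M` behaviourally correctly (BC) learns `C`. -/
def BCLearns (M : List (Option ℕ) → ℕ) (C : Set (Set ℕ)) : Prop :=
  ∀ L ∈ C, ∀ T : ℕ → Option ℕ, IsText T L →
    ∀ᶠ n in atTop, Wset (M (pref T n)) = L

/-- `M` explanatorily (Ex) learns `C`. -/
def ExLearns (M : List (Option ℕ) → ℕ) (C : Set (Set ℕ)) : Prop :=
  ∀ L ∈ C, ∀ T : ℕ → Option ℕ, IsText T L →
    ∃ e n₀, Wset e = L ∧ ∀ n ≥ n₀, M (pref T n) = e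

/-- `M` weakly approximately (WeakApprox) learns `C`: for every text there is
an infinite set `W` such that on every finite variant `V` of `W` almost all
hypotheses agree with the target. -/
def WeakApproxLearns (M : List (Option ℕ) → ℕ) (C : Set (Set ℕ)) : Prop :=
  ∀ L ∈ C, ∀ T : ℕ → Option ℕ, IsText T L →
    ∃ W : Set ℕ, W.Infinite ∧ ∀ V : Set ℕ, (symmDiff V W).Finite →
      ∀ᶠ n in atTop, Wset (M (pref T n)) ∩ V = L ∩ V

/-- `M` approximately (Approx) learns `C`: for every `L ∈ C` there is an
infinite set `W`, good for all texts for `L`. -/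
def ApproxLearns (M : List (Option ℕ) → ℕ) (C : Set (Set ℕ)) : Prop :=
  ∀ L ∈ C, ∃ W : Set ℕ, W.Infinite ∧ ∀ T : ℕ → Option ℕ, IsText T L →
    ∀ V : Set ℕ, (symmDiff V W).Finite →
      ∀ᶠ n in atTop, Wset (M (pref T n)) ∩ V = L ∩ V

/-- Conservativeness for partial learners: on each text for every `L ∈ C`, `M`
outputs exactly one index `e` with `L ⊆ W_e`. -/
def ConsvLearner (M : List (Option ℕ) → ℕ) (C : Set (Set ℕ)) : Prop :=
  ∀ L ∈ C, ∀ T : ℕ → Option ℕ, IsText T L →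
    ∃! e, (∃ n, M (pref T n) = e) ∧ L ⊆ Wset e

/-- Confidence: on every infinite sequence, `M` outputs exactly one index
infinitely often. -/
def Confident (M : List (Option ℕ) → ℕ) : Prop :=
  ∀ T : ℕ → Option ℕ, ∃! e, {n | M (pref T n) = e}.Infinite

/-- The sets ever conjectured by `M` (used to express prudence). -/
def Conjectured (M : List (Option ℕ) → ℕ) : Set (Set ℕ) :=
  {S | ∃ σ : List (Option ℕ), S = Wset (M σ)}

/-- The adversarial text against `M`, as a sequence of (prefix read so far, last number shown):
the number `k` is repeated until `M` conjectures a set omitting `k + 1`, which is shown next. -/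
noncomputable def adversary (M : List (Option ℕ) → ℕ) : ℕ → List (Option ℕ) × ℕ
  | 0 => ([some 0], 0)
  | n + 1 =>
    open Classical in
    let s := adversary M n
    let k := if s.2 + 1 ∈ Wset (M s.1) then s.2 else s.2 + 1
    (s.1 ++ [some k], k)

/-- The text presented by `adversary M`. -/
noncomputable def adversaryText (M : List (Option ℕ) → ℕ) (n : ℕ) : Option ℕ :=
  some (adversary M n).2

lemma adversary_fst (M : List (Option ℕ) → ℕ) (n : ℕ) :
    (adversary M n).1 = pref (adversaryText M) (n + 1) := by
  induction n with
  | zero => simp [adversary, pref, adversaryText]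
  | succ n ih =>
    rw [pref, List.range_succ, List.map_append, ← pref, ← ih]
    simp [adversary, adversaryText]

lemma adversary_snd_succ_of_mem {M : List (Option ℕ) → ℕ} {n : ℕ}
    (h : (adversary M n).2 + 1 ∈ Wset (M (pref (adversaryText M) (n + 1)))) :
    (adversary M (n + 1)).2 = (adversary M n).2 := by
  rw [← adversary_fst] at h
  simp [adversary, h]

lemma adversary_snd_succ_of_notMem {M : List (Option ℕ) → ℕ} {n : ℕ}
    (h : (adversary M n).2 + 1 ∉ Wset (M (pref (adversaryText M) (n + 1)))) :
    (adversary M (n + 1)).2 = (adversary M n).2 + 1 := by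
  rw [← adversary_fst] at h
  simp [adversary, h]

lemma monotone_adversary_snd (M : List (Option ℕ) → ℕ) :
    Monotone fun n => (adversary M n).2 := by
  refine monotone_nat_of_le_succ fun n => ?_
  by_cases h : (adversary M n).2 + 1 ∈ Wset (M (pref (adversaryText M) (n + 1)))
  · exact (adversary_snd_succ_of_mem h).ge
  · exact (Nat.le_succ _).trans (adversary_snd_succ_of_notMem h).ge

/-- Weak approximation implies pointwise convergence of the hypotheses. -/
lemma WeakApproxLearns.eventually_mem_iff {M : List (Option ℕ) → ℕ} {C : Set (Set ℕ)}
    (hM : WeakApproxLearns M C) {L : Set ℕ} (hL : L ∈ C) {T : ℕ → Option ℕ} (hT : IsText T L)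
    (x : ℕ) : ∀ᶠ n in atTop, (x ∈ Wset (M (pref T n)) ↔ x ∈ L) := by
  obtain ⟨W, -, hW⟩ := hM L hL T hT
  have hfin : (symmDiff (insert x W) W).Finite :=
    (Set.finite_singleton x).subset fun y hy => by
      simp only [Set.mem_symmDiff, Set.mem_insert_iff] at hy
      simp only [Set.mem_singleton_iff]
      tauto
  filter_upwards [hW _ hfin] with n hn
  simpa using Set.ext_iff.mp hn x

/-- The adversarial text shows every number if `M` learns all initial segments. -/
lemma exists_adversary_snd_eq {M : List (Option ℕ) → ℕ} {C : Set (Set ℕ)}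
    (hM : WeakApproxLearns M C) (hC : ∀ m, Set.Iic m ∈ C) (m : ℕ) :
    ∃ n, (adversary M n).2 = m := by
  induction m using Nat.strong_induction_on with
  | _ m ih =>
    obtain _ | m := m
    · exact ⟨0, rfl⟩
    by_contra! hne
    obtain ⟨N, hN⟩ := ih m m.lt_succ_self
    have hconst : ∀ n ≥ N, (adversary M n).2 = m := by
      intro n hn
      induction n, hn using Nat.le_induction with
      | base => exact hN
      | succ n _ hn =>
        by_cases h : (adversary M n).2 + 1 ∈ Wset (M (pref (adversaryText M) (n + 1)))
        · rw [adversary_snd_succ_of_mem h, hn]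
        · exact absurd (by rw [adversary_snd_succ_of_notMem h, hn]) (hne (n + 1))
    have hT : IsText (adversaryText M) (Set.Iic m) := by
      ext x
      simp only [adversaryText, Option.some.injEq, Set.mem_ofPred_eq, Set.mem_Iic]
      refine ⟨?_, fun hx => ih x (Nat.lt_succ_of_le hx)⟩
      rintro ⟨n, rfl⟩
      exact (monotone_adversary_snd M (le_max_left n N)).trans
        (hconst _ (le_max_right n N)).le
    obtain ⟨K, hK⟩ := eventually_atTop.mp (hM.eventually_mem_iff (hC m) hT (m + 1))
    have hn := hconst (max N K) (le_max_left N K)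
    have hnot : m + 1 ∉ Wset (M (pref (adversaryText M) (max N K + 1))) := fun h => by
      simpa using (hK _ ((le_max_right N K).trans (Nat.le_succ _))).mp h
    rw [← hn] at hnot
    exact hne _ (by rw [adversary_snd_succ_of_notMem hnot, hn])

/-- Gold's class, consisting of ℕ and all initial segments {0,...,m}, is not
weakly approximately learnable. -/
theorem stmt5 :
    ¬ ∃ M : List (Option ℕ) → ℕ, Computable M ∧
      WeakApproxLearns M ({Set.univ} ∪ {L : Set ℕ | ∃ m : ℕ, L = Set.Iic m}) := by
  rintro ⟨M, -, hM⟩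
  have hsurj := exists_adversary_snd_eq hM fun m => Or.inr ⟨m, rfl⟩
  have hT : IsText (adversaryText M) Set.univ := by
    ext x
    simpa [adversaryText] using hsurj x
  obtain ⟨W, hinf, hW⟩ := hM _ (Or.inl rfl) _ hT
  obtain ⟨N, hN⟩ := eventually_atTop.mp (hW W (by simp))
  obtain ⟨w, hwW, hw⟩ := hinf.exists_gt (adversary M N).2
  have hbelow : ∀ n ≥ N, (adversary M n).2 < w := by
    intro n hn
    induction n, hn using Nat.le_induction with
    | base => exact hw
    | succ n hn ih =>
      by_cases h : (adversary M n).2 + 1 ∈ Wset (M (pref (adversaryText M) (n + 1)))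
      · rwa [adversary_snd_succ_of_mem h]
      · rw [adversary_snd_succ_of_notMem h]
        refine lt_of_le_of_ne ih fun heq => h ?_
        have hw_mem : w ∈ Wset (M (pref (adversaryText M) (n + 1))) ∩ W := by
          rw [hN _ (hn.trans (Nat.le_succ n))]
          exact ⟨trivial, hwW⟩
        rw [heq]
        exact hw_mem.1
  obtain ⟨n, hn⟩ := hsurj w
  exact (hbelow _ (le_max_right n N)).not_ge
    (hn.ge.trans (monotone_adversary_snd M (le_max_left n N)))
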